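/- Define H(τ,ρ) := 24 F(τ,ρ) − r(τ,ρ), where F(τ,ρ) = −(w^{1/2}/θ₄(τ)) ∑_{n∈ℤ} (−1)ⁿ q^{n²/2 − 1/8}/(1 − w q^{n−1/2}), w = e^{2πiρ}, and r(τ,ρ) = 4(θ₂(τ)² θ₂(τ,ρ)² + θ₃(τ)² θ₃(τ,ρ)²)/(θ₂(τ,ρ) θ₃(τ,ρ) θ₄(τ,ρ)). Then for every τ ∈ ℍ, H(τ,·) is meromorphic on ℂ, its poles are all simple and located exactly at the points ρ = (m + nτ)/2 with m, n ∈ ℤ not both even, and Res_{ρ=1/2} H(τ,ρ) = 4/(π θ₂(τ)), Res_{ρ=τ/2} H(τ,ρ) = −4 i q^{1/8}/(π θ₄(τ)), Res_{ρ=(1+τ)/2} H(τ,ρ) = 4 q^{1/8}/(π θ₃(τ)). -/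

import Mathlib

open Complex

noncomputable section

/-- `e^{2πiτs}`, i.e. `q^s` for `q = e^{2πiτ}`. -/
def qp (τ s : ℂ) : ℂ := Complex.exp (2 * (Real.pi : ℂ) * Complex.I * τ * s)

/-- Jacobi theta function `θ₂(τ,v) = ∑_{r∈ℤ+1/2} q^{r²/2} e^{2πirv}`. -/
def theta2e (τ v : ℂ) : ℂ :=
  ∑' n : ℤ, qp τ (((n : ℂ) + 1 / 2) ^ 2 / 2) *
    Complex.exp (2 * (Real.pi : ℂ) * Complex.I * ((n : ℂ) + 1 / 2) * v)

/-- Jacobi theta function `θ₃(τ,v) = ∑_{n∈ℤ} q^{n²/2} e^{2πinv}`. -/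
def theta3e (τ v : ℂ) : ℂ :=
  ∑' n : ℤ, qp τ ((n : ℂ) ^ 2 / 2) *
    Complex.exp (2 * (Real.pi : ℂ) * Complex.I * (n : ℂ) * v)

/-- Jacobi theta function `θ₄(τ,v) = ∑_{n∈ℤ} (−1)ⁿ q^{n²/2} e^{2πinv}`. -/
def theta4e (τ v : ℂ) : ℂ :=
  ∑' n : ℤ, (-1 : ℂ) ^ n * qp τ ((n : ℂ) ^ 2 / 2) *
    Complex.exp (2 * (Real.pi : ℂ) * Complex.I * (n : ℂ) * v)

/-- Theta constant `θ₂(τ) = θ₂(τ,0)`. -/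
def theta2 (τ : ℂ) : ℂ := theta2e τ 0

/-- Theta constant `θ₃(τ) = θ₃(τ,0)`. -/
def theta3 (τ : ℂ) : ℂ := theta3e τ 0

/-- Theta constant `θ₄(τ) = θ₄(τ,0)`. -/
def theta4 (τ : ℂ) : ℂ := theta4e τ 0

/-- The mock Jacobi form
`F(τ,ρ) = −(w^{1/2}/θ₄(τ)) ∑_{n∈ℤ} (−1)ⁿ q^{n²/2−1/8}/(1 − w q^{n−1/2})`, `w = e^{2πiρ}`. -/
def Fe (τ ρ : ℂ) : ℂ :=
  -(Complex.exp ((Real.pi : ℂ) * Complex.I * ρ) / theta4 τ) *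
    ∑' n : ℤ, (-1 : ℂ) ^ n * qp τ ((n : ℂ) ^ 2 / 2 - 1 / 8) /
      (1 - Complex.exp (2 * (Real.pi : ℂ) * Complex.I * ρ) * qp τ ((n : ℂ) - 1 / 2))

/-- `r(τ,ρ) = 4(θ₂(τ)²θ₂(τ,ρ)² + θ₃(τ)²θ₃(τ,ρ)²)/(θ₂(τ,ρ)θ₃(τ,ρ)θ₄(τ,ρ))`. -/
def rJ (τ ρ : ℂ) : ℂ :=
  4 * (theta2 τ ^ 2 * theta2e τ ρ ^ 2 + theta3 τ ^ 2 * theta3e τ ρ ^ 2) /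
    (theta2e τ ρ * theta3e τ ρ * theta4e τ ρ)

/-- The mock Jacobi form `H(τ,ρ) = 24 F(τ,ρ) − r(τ,ρ)`. -/
def HJ (τ ρ : ℂ) : ℂ := 24 * Fe τ ρ - rJ τ ρ

open Filter Topology


/-- The infinite product `∏ (1 + p^{2n} x)`. -/
def Gp (p x : ℂ) : ℂ := ∏' n : ℕ, (1 + p ^ (2 * n) * x)

lemma Gp_summable {p : ℂ} (hp : ‖p‖ < 1) (x : ℂ) :
    Summable fun n : ℕ => ‖p ^ (2 * n) * x‖ := by
  have h1 : ‖p ^ 2‖ < 1 := by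
    rw [norm_pow]; exact pow_lt_one₀ (norm_nonneg _) hp two_ne_zero
  have := (summable_geometric_of_lt_one (norm_nonneg _) h1).mul_right ‖x‖
  refine this.congr fun n => ?_
  rw [norm_mul, pow_mul, norm_pow (p ^ 2) n]

lemma Gp_multipliable {p : ℂ} (hp : ‖p‖ < 1) (x : ℂ) :
    Multipliable fun n : ℕ => (1 + p ^ (2 * n) * x) :=
  multipliable_one_add_of_summable (Gp_summable hp x)

lemma Gp_step {p : ℂ} (hp : ‖p‖ < 1) (x : ℂ) : Gp p x = (1 + x) * Gp p (p ^ 2 * x) := by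
  unfold Gp
  rw [tprod_eq_zero_mul']
  · simp only [mul_zero, pow_zero, one_mul]
    congr 1
    refine tprod_congr fun n => ?_
    ring
  · refine (Gp_multipliable hp (p ^ 2 * x)).congr fun n => ?_
    ring

lemma Gp_ne_zero {p : ℂ} (hp : ‖p‖ < 1) {x : ℂ} (h : ∀ n : ℕ, 1 + p ^ (2 * n) * x ≠ 0) :
    Gp p x ≠ 0 :=
  tprod_one_add_ne_zero_of_summable h (Gp_summable hp x)

lemma Gp_ne_zero_of_lt {p : ℂ} (hp : ‖p‖ < 1) {x : ℂ} (hx : ‖x‖ < 1) :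
    Gp p x ≠ 0 := by
  refine Gp_ne_zero hp fun n h => ?_
  have h2 : p ^ (2 * n) * x = -1 := by linear_combination h
  have h3 : ‖p ^ (2 * n) * x‖ = 1 := by rw [h2]; simp
  rw [norm_mul, norm_pow] at h3
  have : ‖p‖ ^ (2 * n) ≤ 1 := pow_le_one₀ (norm_nonneg _) hp.le
  nlinarith [norm_nonneg x]

lemma Gp_eq_zero {p x : ℂ} (n : ℕ) (h : 1 + p ^ (2 * n) * x = 0) : Gp p x = 0 :=
  tprod_of_exists_eq_zero ⟨n, h⟩

lemma Gp_continuous {p : ℂ} (hp : ‖p‖ < 1) : Continuous (Gp p) := by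
  rw [continuous_iff_continuousAt]
  intro x
  unfold ContinuousAt Gp
  refine tendsto_tprod_one_add_of_dominated_convergence
    (bound := fun n => ‖p ^ (2 * n) * ((‖x‖ + 1 : ℝ) : ℂ)‖) (Gp_summable hp _) ?_ ?_
  · intro k
    exact (continuous_const.mul continuous_id).tendsto x
  · filter_upwards [Metric.ball_mem_nhds x one_pos] with y hy k
    rw [norm_mul, norm_mul]
    gcongr
    rw [Complex.norm_real, Real.norm_of_nonneg (by positivity)]
    have : ‖y‖ ≤ ‖x‖ + ‖y - x‖ := by
      simpa using norm_add_le x (y - x)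
    rw [Metric.mem_ball, dist_eq_norm] at hy
    linarith

/-- `1/(p²;p²)_m`, zero for negative `m`. -/
def Rp (p : ℂ) (m : ℤ) : ℂ := Gp p (-(p ^ 2) ^ (m + 1)) / Gp p (-p ^ 2)

lemma normsq_lt {p : ℂ} (hp : ‖p‖ < 1) : ‖-p ^ 2‖ < 1 := by
  rw [norm_neg, norm_pow]; exact pow_lt_one₀ (norm_nonneg _) hp two_ne_zero

lemma Rp_step {p : ℂ} (hp : ‖p‖ < 1) (hp0 : p ≠ 0) (m : ℤ) :
    Rp p m = (1 - (p ^ 2) ^ (m + 1)) * Rp p (m + 1) := by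
  unfold Rp
  rw [Gp_step hp, zpow_add_one₀ (pow_ne_zero 2 hp0) (m + 1)]
  rw [show p ^ 2 * -(p ^ 2) ^ (m + 1) = -((p ^ 2) ^ (m + 1) * p ^ 2) by ring]
  ring

lemma Rp_neg {p : ℂ} (hp0 : p ≠ 0) {m : ℤ} (hm : m < 0) : Rp p m = 0 := by
  unfold Rp
  obtain ⟨k, hk⟩ := Int.eq_ofNat_of_zero_le (show 0 ≤ -(m + 1) by omega)
  rw [Gp_eq_zero k, zero_div]
  rw [pow_mul, ← zpow_natCast (p ^ 2) k, ← hk, mul_neg, ← zpow_add₀ (pow_ne_zero 2 hp0)]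
  simp

lemma Rp_zero {p : ℂ} (hp : ‖p‖ < 1) : Rp p 0 = 1 := by
  unfold Rp
  simp only [zero_add, zpow_one]
  exact div_self (Gp_ne_zero_of_lt hp (normsq_lt hp))

lemma Gp_zero (p : ℂ) : Gp p 0 = 1 := by simp [Gp]

lemma Rp_tendsto {p : ℂ} (hp : ‖p‖ < 1) :
    Tendsto (fun n : ℕ => Rp p n) atTop (𝓝 (1 / Gp p (-p ^ 2))) := by
  unfold Rp
  refine Tendsto.div_const ?_ _
  rw [← Gp_zero p]
  refine ((Gp_continuous hp).tendsto 0).comp ?_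
  have h1 : ‖p ^ 2‖ < 1 := by simpa using normsq_lt hp
  have := ((tendsto_pow_atTop_nhds_zero_of_norm_lt_one h1).comp (tendsto_add_atTop_nat 1)).neg
  rw [neg_zero] at this
  refine this.congr fun n => ?_
  simp only [Function.comp]
  norm_cast

lemma Rp_bound {p : ℂ} (hp : ‖p‖ < 1) (hp0 : p ≠ 0) : ∃ C : ℝ, ∀ m : ℤ, ‖Rp p m‖ ≤ C := by
  obtain ⟨C, hC⟩ := (Rp_tendsto hp).norm.bddAbove_range
  refine ⟨C, fun m => ?_⟩
  rcases lt_or_ge m 0 with h | h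
  · rw [Rp_neg hp0 h, norm_zero]
    exact (norm_nonneg _).trans (hC ⟨0, rfl⟩)
  · obtain ⟨k, rfl⟩ := Int.eq_ofNat_of_zero_le h
    exact hC ⟨k, rfl⟩

lemma one_sub_pow_ne {p : ℂ} (hp : ‖p‖ < 1) {n : ℕ} (hn : n ≠ 0) : 1 - (p ^ 2) ^ n ≠ 0 := by
  intro h
  have h2 : (p ^ 2) ^ n = 1 := by linear_combination -h
  have h3 : ‖p ^ 2‖ ^ n = 1 := by rw [← norm_pow, h2]; simp
  have h1 : ‖p ^ 2‖ < 1 := by simpa using normsq_lt hp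
  have := pow_lt_one₀ (norm_nonneg _) h1 hn
  linarith

lemma finite_triple {p : ℂ} (hp : ‖p‖ < 1) (hp0 : p ≠ 0) {w : ℂ} (hw : w ≠ 0) (N : ℕ) :
    HasSum (fun k : ℤ => Rp p (N - k) * Rp p (N + k) * (p ^ (k ^ 2) * w ^ k))
      (Rp p (2 * N) * ((∏ n ∈ Finset.range N, (1 + p ^ (2 * n) * (p * w))) *
        ∏ n ∈ Finset.range N, (1 + p ^ (2 * n) * (p / w)))) := by
  induction N with
  | zero =>
    have := hasSum_single (f := fun k : ℤ => Rp p ((0 : ℕ) - k) * Rp p ((0 : ℕ) + k) *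
      (p ^ (k ^ 2) * w ^ k)) 0 (by
        intro k hk
        rcases lt_or_gt_of_ne hk with h | h
        · rw [Rp_neg hp0 (m := (0 : ℕ) + k) (by simpa using h)]; ring
        · rw [Rp_neg hp0 (m := (0 : ℕ) - k) (by simpa using h)]; ring)
    simpa [Rp_zero hp] using this
  | succ N ih =>
    have h1 : 1 - (p ^ 2) ^ (2 * N + 1) ≠ 0 := one_sub_pow_ne hp (by omega)
    have h2 : 1 - (p ^ 2) ^ (2 * N + 2) ≠ 0 := one_sub_pow_ne hp (by omega)
    have hu := (Equiv.addRight (-1 : ℤ)).hasSum_iff.mpr ih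
    have hd := (Equiv.addRight (1 : ℤ)).hasSum_iff.mpr ih
    have key := ((ih.mul_left (1 + p ^ (4 * N + 2))).add
      ((hu.mul_left (p ^ (2 * N + 1) * w)).add (hd.mul_left (p ^ (2 * N + 1) / w)))).div_const
      ((1 - (p ^ 2) ^ (2 * N + 1)) * (1 - (p ^ 2) ^ (2 * N + 2)))
    convert key using 1
    · rfl
    · funext k
      simp only [Function.comp, Equiv.coe_addRight]
      rw [eq_div_iff (mul_ne_zero h1 h2)]
      have e1 := Rp_step hp hp0 (N - k)
      have e2 := Rp_step hp hp0 (N + k)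
      have e3 := Rp_step hp hp0 (N - k - 1)
      have e4 := Rp_step hp hp0 (N + k - 1)
      rw [sub_add_cancel] at e3 e4
      have a1 : ((N + 1 : ℕ) : ℤ) - k = N - k + 1 := by push_cast; ring
      have a2 : ((N + 1 : ℕ) : ℤ) + k = N + k + 1 := by push_cast; ring
      have a3 : (N : ℤ) - (k + -1) = N - k + 1 := by ring
      have a4 : (N : ℤ) + (k + -1) = N + k - 1 := by ring
      have a5 : (N : ℤ) - (k + 1) = N - k - 1 := by ring
      have a6 : (N : ℤ) + (k + 1) = N + k + 1 := by ring
      rw [a1, a2, a3, a4, a5, a6, e3, e4, e1, e2]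
      have hq : p ^ 2 ≠ 0 := pow_ne_zero 2 hp0
      have b1 : w ^ (k + -1) = w ^ k / w := by
        rw [zpow_add₀ hw]; simp [div_eq_mul_inv]
      have b2 : w ^ (k + 1) = w ^ k * w := zpow_add_one₀ hw k
      have b3 : p ^ ((k + -1) ^ 2) = p ^ (k ^ 2) * p / (p ^ 2) ^ k := by
        rw [← zpow_natCast p 2, ← zpow_mul, eq_div_iff (zpow_ne_zero _ hp0), ← zpow_add₀ hp0,
          ← zpow_add_one₀ hp0]
        congr 1; push_cast; ring
      have b4 : p ^ ((k + 1) ^ 2) = p ^ (k ^ 2) * p * (p ^ 2) ^ k := by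
        rw [← zpow_natCast p 2, ← zpow_mul, ← zpow_add_one₀ hp0, ← zpow_add₀ hp0]
        congr 1; push_cast; ring
      rw [b1, b2, b3, b4]
      have c1 : (p ^ 2) ^ ((N : ℤ) - k + 1) = (p ^ 2) ^ N / (p ^ 2) ^ k * p ^ 2 := by
        rw [zpow_add_one₀ hq, zpow_sub₀ hq, zpow_natCast]
      have c2 : (p ^ 2) ^ ((N : ℤ) + k + 1) = (p ^ 2) ^ N * (p ^ 2) ^ k * p ^ 2 := by
        rw [zpow_add_one₀ hq, zpow_add₀ hq, zpow_natCast]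
      have c3 : (p ^ 2) ^ ((N : ℤ) - k) = (p ^ 2) ^ N / (p ^ 2) ^ k := by
        rw [zpow_sub₀ hq, zpow_natCast]
      have c4 : (p ^ 2) ^ ((N : ℤ) + k) = (p ^ 2) ^ N * (p ^ 2) ^ k := by
        rw [zpow_add₀ hq, zpow_natCast]
      rw [c1, c2, c3, c4]
      generalize Rp p ((N : ℤ) - k + 1) = X
      generalize Rp p ((N : ℤ) + k + 1) = Y
      have hK : (p ^ 2) ^ k ≠ 0 := zpow_ne_zero _ hq
      generalize (p ^ 2) ^ k = K at *
      generalize p ^ (k ^ 2) = W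
      generalize w ^ k = V
      have d1 : p ^ (4 * N + 2) = ((p ^ 2) ^ N) ^ 2 * p ^ 2 := by ring
      have d2 : p ^ (2 * N + 1) = ((p ^ 2) ^ N) * p := by ring
      have d3 : (p ^ 2) ^ (2 * N + 1) = ((p ^ 2) ^ N) ^ 2 * p ^ 2 := by ring
      have d4 : (p ^ 2) ^ (2 * N + 2) = ((p ^ 2) ^ N) ^ 2 * p ^ 4 := by ring
      rw [d1, d2, d3, d4]
      generalize (p ^ 2) ^ N = A
      field_simp
      ring
    · rw [Finset.prod_range_succ, Finset.prod_range_succ]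
      have e1 := Rp_step hp hp0 (2 * N)
      have e2 := Rp_step hp hp0 (2 * N + 1)
      have a1 : (2 * (N : ℤ) + 1 + 1) = 2 * ((N + 1 : ℕ) : ℤ) := by push_cast; ring
      rw [a1] at e2
      rw [e2] at e1
      have f1 : (p ^ 2) ^ (2 * (N : ℤ) + 1) = (p ^ 2) ^ (2 * N + 1) := by norm_cast
      have f2 : (p ^ 2) ^ (2 * ((N + 1 : ℕ) : ℤ)) = (p ^ 2) ^ (2 * N + 2) := by norm_cast
      rw [f1, f2] at e1
      rw [eq_div_iff (mul_ne_zero h1 h2), e1]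
      have d1 : p ^ (4 * N + 2) = (p ^ (2 * N)) ^ 2 * p ^ 2 := by ring
      have d2 : p ^ (2 * N + 1) = p ^ (2 * N) * p := by ring
      rw [d1, d2]
      generalize Rp p _ = X
      generalize (1 - (p ^ 2) ^ (2 * N + 1)) = h
      generalize (1 - (p ^ 2) ^ (2 * N + 2)) = h'
      generalize p ^ (2 * N) = A
      field_simp
      ring

/-- Jacobi triple product. -/
lemma triple_product {p : ℂ} (hp : ‖p‖ < 1) (hp0 : p ≠ 0) {w : ℂ} (hw : w ≠ 0)
    (hs : Summable fun k : ℤ => p ^ (k ^ 2) * w ^ k) :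
    ∑' k : ℤ, p ^ (k ^ 2) * w ^ k = Gp p (-p ^ 2) * Gp p (p * w) * Gp p (p / w) := by
  set E := Gp p (-p ^ 2) with hE
  have hE0 : E ≠ 0 := Gp_ne_zero_of_lt hp (normsq_lt hp)
  obtain ⟨C, hC⟩ := Rp_bound hp hp0
  have hC0 : 0 ≤ C := (norm_nonneg _).trans (hC 0)
  have t1 : Tendsto (fun N : ℕ => ∑' k : ℤ, Rp p (N - k) * Rp p (N + k) * (p ^ (k ^ 2) * w ^ k))
      atTop (𝓝 (∑' k : ℤ, (1 / E) * (1 / E) * (p ^ (k ^ 2) * w ^ k))) := by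
    refine tendsto_tsum_of_dominated_convergence
      (bound := fun k : ℤ => C * C * ‖p ^ (k ^ 2) * w ^ k‖) (hs.norm.mul_left _) ?_ ?_
    · intro k
      refine Tendsto.mul_const _ (Tendsto.mul ?_ ?_)
      · have : Tendsto (fun N : ℕ => ((N : ℤ) - k).toNat) atTop atTop :=
          tendsto_atTop.mpr fun b => by
            filter_upwards [eventually_ge_atTop (b + k.natAbs)] with N hN
            omega
        refine ((Rp_tendsto hp).comp this).congr' ?_
        filter_upwards [eventually_ge_atTop k.natAbs] with N hN
        simp only [Function.comp]
        rw [Int.toNat_of_nonneg (by omega)]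
      · have : Tendsto (fun N : ℕ => ((N : ℤ) + k).toNat) atTop atTop :=
          tendsto_atTop.mpr fun b => by
            filter_upwards [eventually_ge_atTop (b + k.natAbs)] with N hN
            omega
        refine ((Rp_tendsto hp).comp this).congr' ?_
        filter_upwards [eventually_ge_atTop k.natAbs] with N hN
        simp only [Function.comp]
        rw [Int.toNat_of_nonneg (by omega)]
    · refine Eventually.of_forall fun N k => ?_
      rw [norm_mul, norm_mul]
      gcongr
      · exact hC _
      · exact hC _
  have t2 : Tendsto (fun N : ℕ => (Rp p (2 * N) *
      ((∏ n ∈ Finset.range N, (1 + p ^ (2 * n) * (p * w))) *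
        ∏ n ∈ Finset.range N, (1 + p ^ (2 * n) * (p / w))))) atTop
      (𝓝 ((1 / E) * (Gp p (p * w) * Gp p (p / w)))) := by
    refine Tendsto.mul ?_ (Tendsto.mul ?_ ?_)
    · have : Tendsto (fun N : ℕ => 2 * N) atTop atTop :=
        tendsto_atTop.mpr fun b => by
          filter_upwards [eventually_ge_atTop b] with N hN
          omega
      refine ((Rp_tendsto hp).comp this).congr fun N => ?_
      simp
    · exact (Gp_multipliable hp _).hasProd.tendsto_prod_nat
    · exact (Gp_multipliable hp _).hasProd.tendsto_prod_nat
  have t3 := tendsto_nhds_unique (t1.congr fun N => (finite_triple hp hp0 hw N).tsum_eq) t2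
  rw [tsum_mul_left] at t3
  field_simp at t3
  rw [t3]


/-- The nome. -/
def nm (τ : ℂ) : ℂ := Complex.exp ((Real.pi : ℂ) * Complex.I * τ)

lemma nm_ne (τ : ℂ) : nm τ ≠ 0 := Complex.exp_ne_zero _

lemma nm_lt {τ : ℂ} (hτ : 0 < τ.im) : ‖nm τ‖ < 1 := by
  unfold nm
  rw [Complex.norm_exp, Real.exp_lt_one_iff]
  have : ((Real.pi : ℂ) * Complex.I * τ).re = -(Real.pi * τ.im) := by simp
  rw [this]
  have := mul_pos Real.pi_pos hτ
  linarith

lemma J_term (τ z : ℂ) (n : ℤ) : jacobiTheta₂_term n z τ =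
    nm τ ^ (n ^ 2) * (Complex.exp (2 * (Real.pi : ℂ) * Complex.I * z)) ^ n := by
  unfold jacobiTheta₂_term nm
  rw [← Complex.exp_int_mul, ← Complex.exp_int_mul, ← Complex.exp_add]
  congr 1
  push_cast; ring

lemma J_prod {τ : ℂ} (hτ : 0 < τ.im) (z : ℂ) : jacobiTheta₂ z τ =
    Gp (nm τ) (-nm τ ^ 2) * Gp (nm τ) (nm τ * Complex.exp (2 * (Real.pi : ℂ) * Complex.I * z)) *
      Gp (nm τ) (nm τ / Complex.exp (2 * (Real.pi : ℂ) * Complex.I * z)) := by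
  rw [← triple_product (nm_lt hτ) (nm_ne τ) (Complex.exp_ne_zero _)]
  · unfold jacobiTheta₂
    exact tsum_congr fun n => J_term τ z n
  · exact ((summable_jacobiTheta₂_term_iff z τ).mpr hτ).congr fun n => J_term τ z n

lemma qp_add (τ a b : ℂ) : qp τ (a + b) = qp τ a * qp τ b := by
  unfold qp; rw [← Complex.exp_add]; congr 1; ring

lemma th3_eq (τ v : ℂ) : theta3e τ v = jacobiTheta₂ v τ := by
  unfold theta3e jacobiTheta₂ jacobiTheta₂_term qp
  refine tsum_congr fun n => ?_
  rw [← Complex.exp_add]; congr 1; ring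

lemma neg_one_zpow_eq (n : ℤ) : (-1 : ℂ) ^ n = Complex.exp ((n : ℂ) * (Real.pi * Complex.I)) := by
  rw [Complex.exp_int_mul, Complex.exp_pi_mul_I]

lemma th4_eq (τ v : ℂ) : theta4e τ v = jacobiTheta₂ (v + 1 / 2) τ := by
  unfold theta4e jacobiTheta₂ jacobiTheta₂_term qp
  refine tsum_congr fun n => ?_
  rw [neg_one_zpow_eq, ← Complex.exp_add, ← Complex.exp_add]; congr 1; ring

lemma th2_eq (τ v : ℂ) : theta2e τ v = qp τ (1 / 8) *
    Complex.exp ((Real.pi : ℂ) * Complex.I * v) * jacobiTheta₂ (v + τ / 2) τ := by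
  unfold theta2e jacobiTheta₂ jacobiTheta₂_term qp
  rw [← tsum_mul_left]
  refine tsum_congr fun n => ?_
  rw [← Complex.exp_add, ← Complex.exp_add, ← Complex.exp_add]; congr 1; ring

lemma exp_eq_neg_one {x : ℂ} (h : Complex.exp ((Real.pi : ℂ) * Complex.I * x) = -1) :
    ∃ k : ℤ, x = 2 * k + 1 := by
  rw [← Complex.exp_pi_mul_I, Complex.exp_eq_exp_iff_exists_int] at h
  obtain ⟨k, hk⟩ := h
  refine ⟨k, ?_⟩
  have h0 : (Real.pi : ℂ) * Complex.I ≠ 0 :=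
    mul_ne_zero (by exact_mod_cast Real.pi_ne_zero) Complex.I_ne_zero
  apply mul_left_cancel₀ h0
  rw [hk]; ring

lemma J_zero {τ : ℂ} (hτ : 0 < τ.im) {z : ℂ} (h : jacobiTheta₂ z τ = 0) :
    ∃ m n : ℤ, Odd m ∧ Odd n ∧ z = ((m : ℂ) + (n : ℂ) * τ) / 2 := by
  by_contra hcon
  push Not at hcon
  rw [J_prod hτ] at h
  refine mul_ne_zero (mul_ne_zero (Gp_ne_zero_of_lt (nm_lt hτ) (normsq_lt (nm_lt hτ)))
    (Gp_ne_zero (nm_lt hτ) ?_)) (Gp_ne_zero (nm_lt hτ) ?_) h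
  · intro n hn
    have h1 : Complex.exp ((Real.pi : ℂ) * Complex.I * ((2 * n + 1) * τ + 2 * z)) = -1 := by
      rw [← sub_eq_zero, ← hn, nm, ← Complex.exp_nat_mul, ← Complex.exp_add, ← Complex.exp_add]
      rw [sub_neg_eq_add, add_comm]
      congr 2
      push_cast; ring
    obtain ⟨k, hk⟩ := exp_eq_neg_one h1
    refine hcon (2 * k + 1) (-(2 * n + 1)) ⟨k, rfl⟩ (Odd.neg ⟨n, rfl⟩) ?_
    push_cast
    linear_combination hk / 2
  · intro n hn
    have h1 : Complex.exp ((Real.pi : ℂ) * Complex.I * ((2 * n + 1) * τ - 2 * z)) = -1 := by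
      rw [← sub_eq_zero, ← hn, nm, ← Complex.exp_nat_mul, ← Complex.exp_sub, ← Complex.exp_add]
      rw [sub_neg_eq_add, add_comm]
      congr 2
      push_cast; ring
    obtain ⟨k, hk⟩ := exp_eq_neg_one h1
    refine hcon (-(2 * k + 1)) (2 * n + 1) (Odd.neg ⟨k, rfl⟩) ⟨n, rfl⟩ ?_
    push_cast
    linear_combination -hk / 2

/-- `E = ∏ (1 - q^n)`. -/
def Ee (τ : ℂ) : ℂ := Gp (nm τ) (-nm τ ^ 2)

lemma Ee_ne {τ : ℂ} (hτ : 0 < τ.im) : Ee τ ≠ 0 :=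
  Gp_ne_zero_of_lt (nm_lt hτ) (normsq_lt (nm_lt hτ))

lemma exp_slope (ρ₀ : ℂ) : Tendsto (fun ρ : ℂ =>
    (Complex.exp (2 * (Real.pi : ℂ) * Complex.I * (ρ - ρ₀)) - 1) / (ρ - ρ₀)) (𝓝[≠] ρ₀)
    (𝓝 (2 * (Real.pi : ℂ) * Complex.I)) := by
  have h : HasDerivAt (fun ρ : ℂ => Complex.exp (2 * (Real.pi : ℂ) * Complex.I * (ρ - ρ₀)))
      (2 * (Real.pi : ℂ) * Complex.I) ρ₀ := by
    have := (((hasDerivAt_id ρ₀).sub_const ρ₀).const_mul (2 * (Real.pi : ℂ) * Complex.I)).cexp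
    simpa using this
  have := hasDerivAt_iff_tendsto_slope.mp h
  refine this.congr fun ρ => ?_
  rw [slope_def_field]; simp

lemma J_slope {τ : ℂ} (hτ : 0 < τ.im) (a ρ₀ : ℂ) (h0 : ρ₀ + a = (1 + τ) / 2) :
    Tendsto (fun ρ : ℂ => jacobiTheta₂ (ρ + a) τ / (ρ - ρ₀)) (𝓝[≠] ρ₀)
      (𝓝 (2 * (Real.pi : ℂ) * Complex.I * Ee τ ^ 3)) := by
  have hp := nm_lt hτ
  set p := nm τ with hpdef
  set u : ℂ → ℂ := fun ρ => Complex.exp (2 * (Real.pi : ℂ) * Complex.I * (ρ - ρ₀)) with hu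
  have huc : Continuous u := by fun_prop
  have hu0 : u ρ₀ = 1 := by simp [hu]
  have hune : ∀ ρ, u ρ ≠ 0 := fun ρ => Complex.exp_ne_zero _
  have e1 : ∀ ρ, jacobiTheta₂ (ρ + a) τ / (ρ - ρ₀) =
      Ee τ * Gp p (-p ^ 2 * u ρ) * (Gp p (-p ^ 2 / u ρ) / u ρ) * ((u ρ - 1) / (ρ - ρ₀)) := by
    intro ρ
    have e2 : Complex.exp (2 * (Real.pi : ℂ) * Complex.I * (ρ + a)) = -p * u ρ := by
      rw [hu, hpdef, nm]
      rw [show 2 * (Real.pi : ℂ) * Complex.I * (ρ + a) = (Real.pi : ℂ) * Complex.I +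
        (Real.pi : ℂ) * Complex.I * τ + 2 * (Real.pi : ℂ) * Complex.I * (ρ - ρ₀) by
          linear_combination 2 * (Real.pi : ℂ) * Complex.I * h0]
      rw [Complex.exp_add, Complex.exp_add, Complex.exp_pi_mul_I]; ring
    rw [J_prod hτ, e2, ← hpdef]
    have e3 : p / (-p * u ρ) = -1 / u ρ := by
      have := nm_ne τ
      rw [← hpdef] at this
      have := hune ρ
      field_simp
    rw [e3, Gp_step hp (-1 / u ρ), Ee, ← hpdef]
    rw [show p * (-p * u ρ) = -p ^ 2 * u ρ by ring, show p ^ 2 * (-1 / u ρ) = -p ^ 2 / u ρ by ring]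
    have := hune ρ
    field_simp
    ring
  simp_rw [e1]
  have hG := Gp_continuous hp
  have t1 : Tendsto (fun ρ => Ee τ * Gp p (-p ^ 2 * u ρ) * (Gp p (-p ^ 2 / u ρ) / u ρ)) (𝓝[≠] ρ₀)
      (𝓝 (Ee τ * Gp p (-p ^ 2 * u ρ₀) * (Gp p (-p ^ 2 / u ρ₀) / u ρ₀))) := by
    refine (Continuous.tendsto ?_ ρ₀).mono_left nhdsWithin_le_nhds
    refine (continuous_const.mul (hG.comp (continuous_const.mul huc))).mul
      ((hG.comp (continuous_const.div huc hune)).div huc hune)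
  have := t1.mul (exp_slope ρ₀)
  rw [hu0] at this
  convert this using 2
  rw [Ee, ← hpdef]; simp; ring

lemma euler_id {p : ℂ} (hp : ‖p‖ < 1) : Gp p p * Gp p (-p) * Gp p (p ^ 2) = 1 := by
  have hE0 : Gp p (-p ^ 2) ≠ 0 := Gp_ne_zero_of_lt hp (normsq_lt hp)
  have hm1 : Gp p p * Gp p (-p) = ∏' n : ℕ, (1 + p ^ (2 * (2 * n)) * (-p ^ 2)) := by
    unfold Gp
    rw [← (Gp_multipliable hp p).tprod_mul (Gp_multipliable hp (-p))]
    refine tprod_congr fun n => ?_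
    ring
  have hm2 : Gp p (p ^ 2) * Gp p (-p ^ 2) = ∏' n : ℕ, (1 + p ^ (2 * (2 * n + 1)) * (-p ^ 2)) := by
    unfold Gp
    rw [← (Gp_multipliable hp (p ^ 2)).tprod_mul (Gp_multipliable hp (-p ^ 2))]
    refine tprod_congr fun n => ?_
    ring
  have hs := Gp_summable hp (-p ^ 2)
  have m1 : Multipliable fun n : ℕ => (1 + p ^ (2 * (2 * n)) * (-p ^ 2)) :=
    multipliable_one_add_of_summable
      (hs.comp_injective (i := fun n : ℕ => 2 * n) (fun a b h => by simpa using h))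
  have m2 : Multipliable fun n : ℕ => (1 + p ^ (2 * (2 * n + 1)) * (-p ^ 2)) :=
    multipliable_one_add_of_summable
      (hs.comp_injective (i := fun n : ℕ => 2 * n + 1) (fun a b h => by simpa using h))
  have := tprod_even_mul_odd (f := fun n : ℕ => (1 + p ^ (2 * n) * (-p ^ 2))) m1 m2
  rw [← hm1, ← hm2] at this
  change _ = Gp p (-p ^ 2) at this
  apply mul_right_cancel₀ hE0
  linear_combination this

lemma th3_val {τ : ℂ} (hτ : 0 < τ.im) : theta3 τ = Ee τ * Gp (nm τ) (nm τ) ^ 2 := by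
  rw [theta3, th3_eq, J_prod hτ, Ee]; simp; ring

lemma th4_val {τ : ℂ} (hτ : 0 < τ.im) : theta4 τ = Ee τ * Gp (nm τ) (-nm τ) ^ 2 := by
  rw [theta4, th4_eq, J_prod hτ, Ee]
  rw [show 2 * (Real.pi : ℂ) * Complex.I * (0 + 1 / 2) = Real.pi * Complex.I by ring,
    Complex.exp_pi_mul_I]
  rw [mul_neg_one, div_neg, div_one]; ring

lemma th2_val {τ : ℂ} (hτ : 0 < τ.im) :
    theta2 τ = 2 * qp τ (1 / 8) * Ee τ * Gp (nm τ) (nm τ ^ 2) ^ 2 := by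
  rw [theta2, th2_eq, J_prod hτ, Ee]
  rw [show 2 * (Real.pi : ℂ) * Complex.I * (0 + τ / 2) = Real.pi * Complex.I * τ by ring]
  change _ * (_ * _ * Gp (nm τ) (nm τ / nm τ)) = _
  rw [div_self (nm_ne τ), Gp_step (nm_lt hτ) 1, mul_one]
  change _ * (_ * Gp (nm τ) (nm τ * nm τ) * _) = _
  rw [mul_zero, Complex.exp_zero, ← pow_two]; ring

lemma qp_ne (τ s : ℂ) : qp τ s ≠ 0 := Complex.exp_ne_zero _

lemma th3_ne {τ : ℂ} (hτ : 0 < τ.im) : theta3 τ ≠ 0 := by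
  rw [th3_val hτ]
  exact mul_ne_zero (Ee_ne hτ) (pow_ne_zero 2 (Gp_ne_zero_of_lt (nm_lt hτ) (nm_lt hτ)))

lemma th4_ne {τ : ℂ} (hτ : 0 < τ.im) : theta4 τ ≠ 0 := by
  rw [th4_val hτ]
  exact mul_ne_zero (Ee_ne hτ) (pow_ne_zero 2 (Gp_ne_zero_of_lt (nm_lt hτ)
    (by rw [norm_neg]; exact nm_lt hτ)))

lemma th2_ne {τ : ℂ} (hτ : 0 < τ.im) : theta2 τ ≠ 0 := by
  rw [th2_val hτ]
  refine mul_ne_zero (mul_ne_zero (mul_ne_zero two_ne_zero (qp_ne _ _)) (Ee_ne hτ))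
    (pow_ne_zero 2 (Gp_ne_zero_of_lt (nm_lt hτ) ?_))
  simpa using normsq_lt (nm_lt hτ)

/-- Jacobi's derivative formula. -/
lemma jacobi_deriv {τ : ℂ} (hτ : 0 < τ.im) :
    2 * qp τ (1 / 8) * Ee τ ^ 3 = theta2 τ * theta3 τ * theta4 τ := by
  rw [th2_val hτ, th3_val hτ, th4_val hτ]
  have h := euler_id (nm_lt hτ)
  have h2 : (Gp (nm τ) (nm τ) * Gp (nm τ) (-nm τ) * Gp (nm τ) (nm τ ^ 2)) ^ 2 = 1 := by
    rw [h, one_pow]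
  linear_combination (-2 * qp τ (1 / 8) * Ee τ ^ 3) * h2


lemma J_diff {τ : ℂ} (hτ : 0 < τ.im) : Differentiable ℂ fun z => jacobiTheta₂ z τ :=
  fun z => differentiableAt_jacobiTheta₂_fst z hτ

lemma th3_diff {τ : ℂ} (hτ : 0 < τ.im) : Differentiable ℂ (theta3e τ) := by
  rw [show theta3e τ = fun v => jacobiTheta₂ v τ from funext fun v => th3_eq τ v]
  exact J_diff hτ

lemma th4_diff {τ : ℂ} (hτ : 0 < τ.im) : Differentiable ℂ (theta4e τ) := by
  rw [show theta4e τ = fun v => jacobiTheta₂ (v + 1 / 2) τ from funext fun v => th4_eq τ v]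
  exact (J_diff hτ).comp (f := fun v : ℂ => v + 1 / 2) (by fun_prop)

lemma th2_diff {τ : ℂ} (hτ : 0 < τ.im) : Differentiable ℂ (theta2e τ) := by
  rw [show theta2e τ = fun v => qp τ (1 / 8) *
    Complex.exp ((Real.pi : ℂ) * Complex.I * v) * jacobiTheta₂ (v + τ / 2) τ from
    funext fun v => th2_eq τ v]
  exact Differentiable.mul (by fun_prop)
    ((J_diff hτ).comp (f := fun v : ℂ => v + τ / 2) (by fun_prop))

lemma J_root {τ : ℂ} (hτ : 0 < τ.im) : jacobiTheta₂ ((1 + τ) / 2) τ = 0 := by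
  rw [J_prod hτ]
  have : Complex.exp (2 * (Real.pi : ℂ) * Complex.I * ((1 + τ) / 2)) = -nm τ := by
    rw [show 2 * (Real.pi : ℂ) * Complex.I * ((1 + τ) / 2) = (Real.pi : ℂ) * Complex.I +
      (Real.pi : ℂ) * Complex.I * τ by ring, Complex.exp_add, Complex.exp_pi_mul_I, nm]; ring
  rw [this, div_neg, div_self (nm_ne τ), Gp_eq_zero (x := -1) 0 (by simp), mul_zero]

lemma qJ (τ : ℂ) : qp τ (1 / 8) * jacobiTheta₂ (τ / 2) τ = theta2 τ := by
  rw [theta2, th2_eq]; simp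

lemma J_half (τ : ℂ) : jacobiTheta₂ (1 / 2) τ = theta4 τ := by
  rw [theta4, th4_eq]; simp

lemma J_0 (τ : ℂ) : jacobiTheta₂ 0 τ = theta3 τ := by
  rw [theta3, th3_eq]

lemma th4_half (τ : ℂ) : theta4e τ (1 / 2) = theta3 τ := by
  rw [th4_eq, show (1 / 2 + 1 / 2 : ℂ) = 0 + 1 by norm_num, jacobiTheta₂_add_left, J_0]

lemma th3_half (τ : ℂ) : theta3e τ (1 / 2) = theta4 τ := by
  rw [th3_eq, J_half]

lemma th2_half {τ : ℂ} (hτ : 0 < τ.im) : theta2e τ (1 / 2) = 0 := by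
  rw [th2_eq, show (1 / 2 + τ / 2 : ℂ) = (1 + τ) / 2 by ring, J_root hτ, mul_zero]

lemma th2_tau (τ : ℂ) : theta2e τ (τ / 2) = theta3 τ / qp τ (1 / 8) := by
  rw [th2_eq, show (τ / 2 + τ / 2 : ℂ) = 0 + τ by ring, jacobiTheta₂_add_left', J_0,
    eq_div_iff (qp_ne _ _)]
  have : qp τ (1 / 8) * Complex.exp ((Real.pi : ℂ) * Complex.I * (τ / 2)) *
    Complex.exp (-Real.pi * Complex.I * (τ + 2 * 0)) * qp τ (1 / 8) = 1 := by
    rw [qp, ← Complex.exp_add, ← Complex.exp_add, ← Complex.exp_add]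
    convert Complex.exp_zero using 2
    ring
  linear_combination theta3 τ * this

lemma th3_tau (τ : ℂ) : theta3e τ (τ / 2) = theta2 τ / qp τ (1 / 8) := by
  rw [th3_eq, eq_div_iff (qp_ne _ _), ← qJ]; ring

lemma th2_mid (τ : ℂ) : theta2e τ ((1 + τ) / 2) = -Complex.I * theta4 τ / qp τ (1 / 8) := by
  rw [th2_eq, show ((1 + τ) / 2 + τ / 2 : ℂ) = 1 / 2 + τ by ring, jacobiTheta₂_add_left', J_half,
    eq_div_iff (qp_ne _ _)]
  have : qp τ (1 / 8) * Complex.exp ((Real.pi : ℂ) * Complex.I * ((1 + τ) / 2)) *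
    Complex.exp (-Real.pi * Complex.I * (τ + 2 * (1 / 2))) * qp τ (1 / 8) = -Complex.I := by
    rw [qp, ← Complex.exp_add, ← Complex.exp_add, ← Complex.exp_add,
      ← Complex.exp_neg_pi_div_two_mul_I]
    congr 1; ring
  linear_combination theta4 τ * this

lemma th4_mid (τ : ℂ) : theta4e τ ((1 + τ) / 2) = theta2 τ / qp τ (1 / 8) := by
  rw [th4_eq, show ((1 + τ) / 2 + 1 / 2 : ℂ) = τ / 2 + 1 by ring, jacobiTheta₂_add_left,
    eq_div_iff (qp_ne _ _), ← qJ]; ring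

lemma res_gen {N A B C : ℂ → ℂ} {ρ₀ n a b d : ℂ} (hN : Continuous N) (hA : Continuous A)
    (hB : Continuous B) (hC : Tendsto (fun ρ => C ρ / (ρ - ρ₀)) (𝓝[≠] ρ₀) (𝓝 d))
    (hn : N ρ₀ = n) (ha : A ρ₀ = a) (hb : B ρ₀ = b)
    (ha0 : a ≠ 0) (hb0 : b ≠ 0) (hd : d ≠ 0) :
    Tendsto (fun ρ => (ρ - ρ₀) * (N ρ / (A ρ * B ρ * C ρ))) (𝓝[≠] ρ₀) (𝓝 (n / (a * b * d))) := by
  subst hn ha hb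
  have t := (((hN.tendsto ρ₀).mono_left nhdsWithin_le_nhds).div
    ((((hA.tendsto ρ₀).mono_left nhdsWithin_le_nhds).mul
      ((hB.tendsto ρ₀).mono_left nhdsWithin_le_nhds)).mul hC)
      (mul_ne_zero (mul_ne_zero ha0 hb0) hd))
  refine t.congr fun ρ => ?_
  simp only [Pi.div_apply, div_eq_mul_inv, mul_inv, inv_inv]
  ring

lemma D_ne {τ : ℂ} (hτ : 0 < τ.im) : 2 * (Real.pi : ℂ) * Complex.I * Ee τ ^ 3 ≠ 0 :=
  mul_ne_zero Complex.two_pi_I_ne_zero (pow_ne_zero 3 (Ee_ne hτ))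

lemma rnum_cont {τ : ℂ} (hτ : 0 < τ.im) : Continuous fun ρ =>
    4 * (theta2 τ ^ 2 * theta2e τ ρ ^ 2 + theta3 τ ^ 2 * theta3e τ ρ ^ 2) := by
  have h2 := (th2_diff hτ).continuous
  have h3 := (th3_diff hτ).continuous
  fun_prop

lemma r_res_half {τ : ℂ} (hτ : 0 < τ.im) :
    Tendsto (fun ρ => (ρ - 1 / 2) * rJ τ ρ) (𝓝[≠] ((1 : ℂ) / 2))
      (𝓝 (-4 / ((Real.pi : ℂ) * theta2 τ))) := by
  have hs : Tendsto (fun ρ => theta2e τ ρ / (ρ - 1 / 2)) (𝓝[≠] ((1 : ℂ) / 2))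
      (𝓝 (qp τ (1 / 8) * Complex.exp ((Real.pi : ℂ) * Complex.I * (1 / 2)) *
        (2 * (Real.pi : ℂ) * Complex.I * Ee τ ^ 3))) := by
    have t1 : Tendsto (fun ρ : ℂ => qp τ (1 / 8) * Complex.exp ((Real.pi : ℂ) * Complex.I * ρ))
      (𝓝[≠] ((1 : ℂ) / 2)) (𝓝 (qp τ (1 / 8) *
        Complex.exp ((Real.pi : ℂ) * Complex.I * (1 / 2)))) :=
      (Continuous.tendsto (by fun_prop) _).mono_left nhdsWithin_le_nhds
    refine (t1.mul (J_slope hτ (τ / 2) (1 / 2) (by ring))).congr fun ρ => ?_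
    rw [th2_eq]; ring
  have t := res_gen (rnum_cont hτ) (th3_diff hτ).continuous (th4_diff hτ).continuous hs rfl
    (th3_half τ) (th4_half τ) (th4_ne hτ) (th3_ne hτ)
    (mul_ne_zero (mul_ne_zero (qp_ne _ _) (Complex.exp_ne_zero _)) (D_ne hτ))
  have hv : 4 * (theta2 τ ^ 2 * theta2e τ (1 / 2) ^ 2 + theta3 τ ^ 2 * theta3e τ (1 / 2) ^ 2) /
      (theta4 τ * theta3 τ * (qp τ (1 / 8) * Complex.exp ((Real.pi : ℂ) * Complex.I * (1 / 2)) *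
        (2 * (Real.pi : ℂ) * Complex.I * Ee τ ^ 3))) = -4 / ((Real.pi : ℂ) * theta2 τ) := by
    rw [th2_half hτ, th3_half]
    rw [show (Real.pi : ℂ) * Complex.I * (1 / 2) = Real.pi / 2 * Complex.I by ring,
      Complex.exp_pi_div_two_mul_I]
    rw [show qp τ (1 / 8) * Complex.I * (2 * (Real.pi : ℂ) * Complex.I * Ee τ ^ 3) =
      -(Real.pi * (theta2 τ * theta3 τ * theta4 τ)) by
        rw [← jacobi_deriv hτ]
        linear_combination (2 * qp τ (1 / 8) * Real.pi * Ee τ ^ 3) * Complex.I_mul_I]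
    have h2 := th2_ne hτ
    have h3 := th3_ne hτ
    have h4 := th4_ne hτ
    have hpi : (Real.pi : ℂ) ≠ 0 := by exact_mod_cast Real.pi_ne_zero
    field_simp
    ring
  rw [hv] at t
  refine t.congr fun ρ => ?_
  rw [rJ]
  congr 2
  ring

lemma D_eq {τ : ℂ} (hτ : 0 < τ.im) : 2 * (Real.pi : ℂ) * Complex.I * Ee τ ^ 3 =
    Real.pi * Complex.I * (theta2 τ * theta3 τ * theta4 τ) / qp τ (1 / 8) := by
  rw [eq_div_iff (qp_ne _ _), ← jacobi_deriv hτ]; ring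

lemma r_res_mid {τ : ℂ} (hτ : 0 < τ.im) :
    Tendsto (fun ρ => (ρ - (1 + τ) / 2) * rJ τ ρ) (𝓝[≠] ((1 + τ) / 2))
      (𝓝 (-4 * qp τ (1 / 8) / ((Real.pi : ℂ) * theta3 τ))) := by
  have hs := J_slope hτ 0 ((1 + τ) / 2) (by ring)
  simp_rw [add_zero, ← th3_eq] at hs
  have h2 := th2_ne hτ
  have h3 := th3_ne hτ
  have h4 := th4_ne hτ
  have hq := qp_ne τ (1 / 8)
  have hpi : (Real.pi : ℂ) ≠ 0 := by exact_mod_cast Real.pi_ne_zero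
  have t := res_gen (rnum_cont hτ) (th2_diff hτ).continuous (th4_diff hτ).continuous hs rfl
    (th2_mid τ) (th4_mid τ)
    (div_ne_zero (mul_ne_zero (neg_ne_zero.mpr Complex.I_ne_zero) h4) hq)
    (div_ne_zero h2 hq) (D_ne hτ)
  have hv : 4 * (theta2 τ ^ 2 * theta2e τ ((1 + τ) / 2) ^ 2 +
      theta3 τ ^ 2 * theta3e τ ((1 + τ) / 2) ^ 2) /
      (-Complex.I * theta4 τ / qp τ (1 / 8) * (theta2 τ / qp τ (1 / 8)) *
        (2 * (Real.pi : ℂ) * Complex.I * Ee τ ^ 3)) =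
      -4 * qp τ (1 / 8) / ((Real.pi : ℂ) * theta3 τ) := by
    rw [th2_mid, th3_eq, J_root hτ, D_eq hτ]
    have hI := Complex.I_ne_zero
    field_simp
    try ring
  rw [hv] at t
  refine t.congr fun ρ => ?_
  rw [rJ]
  congr 2
  ring

lemma r_res_tau {τ : ℂ} (hτ : 0 < τ.im) :
    Tendsto (fun ρ => (ρ - τ / 2) * rJ τ ρ) (𝓝[≠] (τ / 2))
      (𝓝 (-8 * Complex.I * qp τ (1 / 8) / ((Real.pi : ℂ) * theta4 τ))) := by
  have hs := J_slope hτ (1 / 2) (τ / 2) (by ring)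
  simp_rw [← th4_eq] at hs
  have h2 := th2_ne hτ
  have h3 := th3_ne hτ
  have h4 := th4_ne hτ
  have hq := qp_ne τ (1 / 8)
  have hpi : (Real.pi : ℂ) ≠ 0 := by exact_mod_cast Real.pi_ne_zero
  have t := res_gen (rnum_cont hτ) (th2_diff hτ).continuous (th3_diff hτ).continuous hs rfl
    (th2_tau τ) (th3_tau τ) (div_ne_zero h3 hq) (div_ne_zero h2 hq) (D_ne hτ)
  have hv : 4 * (theta2 τ ^ 2 * theta2e τ (τ / 2) ^ 2 +
      theta3 τ ^ 2 * theta3e τ (τ / 2) ^ 2) /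
      (theta3 τ / qp τ (1 / 8) * (theta2 τ / qp τ (1 / 8)) *
        (2 * (Real.pi : ℂ) * Complex.I * Ee τ ^ 3)) =
      -8 * Complex.I * qp τ (1 / 8) / ((Real.pi : ℂ) * theta4 τ) := by
    rw [th2_tau, th3_tau, D_eq hτ]
    have hI := Complex.I_ne_zero
    field_simp
    rw [Complex.I_sq]
    ring
  rw [hv] at t
  exact t

lemma r_add_one (τ ρ : ℂ) : rJ τ (ρ + 1) = -rJ τ ρ := by
  have e3 : theta3e τ (ρ + 1) = theta3e τ ρ := by rw [th3_eq, th3_eq, jacobiTheta₂_add_left]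
  have e4 : theta4e τ (ρ + 1) = theta4e τ ρ := by
    rw [th4_eq, th4_eq, show ρ + 1 + 1 / 2 = ρ + 1 / 2 + 1 by ring, jacobiTheta₂_add_left]
  have e2 : theta2e τ (ρ + 1) = -theta2e τ ρ := by
    rw [th2_eq, th2_eq, show ρ + 1 + τ / 2 = ρ + τ / 2 + 1 by ring, jacobiTheta₂_add_left,
      mul_add, Complex.exp_add, mul_one, Complex.exp_pi_mul_I]; ring
  rw [rJ, rJ, e2, e3, e4]
  rw [neg_mul, neg_mul, div_neg, neg_sq]

lemma r_add_tau (τ ρ : ℂ) : rJ τ (ρ + τ) = Complex.exp ((Real.pi : ℂ) * Complex.I *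
    (1 + 2 * ρ + τ)) * rJ τ ρ := by
  set m := Complex.exp (-Real.pi * Complex.I * (τ + 2 * ρ)) with hm
  have hm0 : m ≠ 0 := Complex.exp_ne_zero _
  have e3 : theta3e τ (ρ + τ) = m * theta3e τ ρ := by rw [th3_eq, th3_eq, jacobiTheta₂_add_left']
  have e4 : theta4e τ (ρ + τ) = -m * theta4e τ ρ := by
    rw [th4_eq, th4_eq, show ρ + τ + 1 / 2 = ρ + 1 / 2 + τ by ring, jacobiTheta₂_add_left']
    rw [show -(Real.pi : ℂ) * Complex.I * (τ + 2 * (ρ + 1 / 2)) =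
      -Real.pi * Complex.I * (τ + 2 * ρ) + -(Real.pi * Complex.I) by ring, Complex.exp_add,
      Complex.exp_neg, Complex.exp_pi_mul_I, ← hm]
    rw [show ((-1 : ℂ))⁻¹ = -1 by norm_num]; ring
  have e2 : theta2e τ (ρ + τ) = m * theta2e τ ρ := by
    rw [th2_eq, th2_eq, show ρ + τ + τ / 2 = ρ + τ / 2 + τ by ring, jacobiTheta₂_add_left']
    have : Complex.exp (Real.pi * Complex.I * (ρ + τ)) *
      Complex.exp (-Real.pi * Complex.I * (τ + 2 * (ρ + τ / 2))) =
      m * Complex.exp (Real.pi * Complex.I * ρ) := by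
      rw [hm, ← Complex.exp_add, ← Complex.exp_add]; congr 1; ring
    linear_combination (qp τ (1 / 8) * jacobiTheta₂ (ρ + τ / 2) τ) * this
  have hk : Complex.exp ((Real.pi : ℂ) * Complex.I * (1 + 2 * ρ + τ)) = -1 / m := by
    rw [eq_div_iff hm0, hm, ← Complex.exp_add, ← Complex.exp_pi_mul_I]; congr 1; ring
  rw [rJ, rJ, e2, e3, e4, hk]
  generalize theta2e τ ρ = X
  generalize theta3e τ ρ = Y
  generalize theta4e τ ρ = Z
  by_cases hx : X = 0
  · subst hx; simp
  by_cases hy : Y = 0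
  · subst hy; simp
  by_cases hz : Z = 0
  · subst hz; simp
  field_simp

lemma r_add_int (τ ρ : ℂ) (a : ℤ) : rJ τ (ρ + a) = Complex.exp ((Real.pi : ℂ) * Complex.I * a) *
    rJ τ ρ := by
  induction a using Int.induction_on with
  | zero => simp
  | succ i ih =>
    push_cast at ih ⊢
    rw [← add_assoc, r_add_one, ih, mul_add, Complex.exp_add, mul_one, Complex.exp_pi_mul_I]; ring
  | pred i ih =>
    push_cast at ih ⊢
    have h := r_add_one τ (ρ + (-(i : ℂ) - 1))
    rw [show ρ + (-(i : ℂ) - 1) + 1 = ρ + -(i : ℂ) by ring, ih] at h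
    rw [show (Real.pi : ℂ) * Complex.I * (-i - 1) = Real.pi * Complex.I * (-i) +
      -(Real.pi * Complex.I) by ring, Complex.exp_add, Complex.exp_neg (_ * _),
      Complex.exp_pi_mul_I]
    rw [show ((-1 : ℂ))⁻¹ = -1 by norm_num]
    linear_combination h

lemma r_add_int_tau (τ ρ : ℂ) (b : ℤ) : rJ τ (ρ + b * τ) =
    Complex.exp ((Real.pi : ℂ) * Complex.I * (b + 2 * b * ρ + b ^ 2 * τ)) * rJ τ ρ := by
  induction b using Int.induction_on with
  | zero => simp
  | succ i ih =>
    push_cast at ih ⊢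
    rw [show ρ + ((i : ℂ) + 1) * τ = ρ + i * τ + τ by ring, r_add_tau, ih, ← mul_assoc,
      ← Complex.exp_add]
    congr 2
    ring
  | pred i ih =>
    push_cast at ih ⊢
    have h := r_add_tau τ (ρ + (-(i : ℂ) - 1) * τ)
    rw [show ρ + (-(i : ℂ) - 1) * τ + τ = ρ + -(i : ℂ) * τ by ring, ih] at h
    apply mul_left_cancel₀ (Complex.exp_ne_zero (Real.pi * Complex.I *
      (1 + 2 * (ρ + (-(i : ℂ) - 1) * τ) + τ)))
    rw [← h, ← mul_assoc, ← Complex.exp_add]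
    congr 2
    ring

/-- the multiplier -/
def mu (τ : ℂ) (a b : ℤ) (ρ : ℂ) : ℂ :=
  Complex.exp ((Real.pi : ℂ) * Complex.I * (a + b + 2 * b * ρ + b ^ 2 * τ))

lemma r_shift (τ ρ : ℂ) (a b : ℤ) : rJ τ (ρ + (a + b * τ)) = mu τ a b ρ * rJ τ ρ := by
  rw [show ρ + (a + b * τ) = ρ + b * τ + a by ring, r_add_int, r_add_int_tau, ← mul_assoc,
    ← Complex.exp_add, mu]
  congr 2
  ring

lemma r_res_shift {τ ρ₀ c : ℂ} (a b : ℤ)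
    (h : Tendsto (fun ρ => (ρ - ρ₀) * rJ τ ρ) (𝓝[≠] ρ₀) (𝓝 c)) :
    Tendsto (fun ρ => (ρ - (ρ₀ + (a + b * τ))) * rJ τ ρ) (𝓝[≠] (ρ₀ + (a + b * τ)))
      (𝓝 (mu τ a b ρ₀ * c)) := by
  have h1 : Tendsto (mu τ a b) (𝓝[≠] ρ₀) (𝓝 (mu τ a b ρ₀)) :=
    (Continuous.tendsto (by unfold mu; fun_prop) _).mono_left nhdsWithin_le_nhds
  have h2 : Tendsto (fun ρ : ℂ => ρ - (a + b * τ)) (𝓝[≠] (ρ₀ + (a + b * τ))) (𝓝[≠] ρ₀) := by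
    refine tendsto_nhdsWithin_iff.mpr ⟨?_, ?_⟩
    · have : Tendsto (fun ρ : ℂ => ρ - (a + b * τ)) (𝓝 (ρ₀ + (a + b * τ)))
          (𝓝 (ρ₀ + (a + b * τ) - (a + b * τ))) := Continuous.tendsto (by fun_prop) _
      rw [add_sub_cancel_right] at this
      exact this.mono_left nhdsWithin_le_nhds
    · filter_upwards [self_mem_nhdsWithin] with ρ hρ
      simp only [Set.mem_compl_iff, Set.mem_singleton_iff] at hρ ⊢
      intro h; apply hρ; rw [← h]; ring
  refine ((h1.mul h).comp h2).congr fun ρ => ?_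
  simp only [Function.comp]
  conv_rhs => rw [show ρ = ρ - (a + b * τ) + (a + b * τ) by ring, r_shift]
  ring

lemma c_norm (τ : ℂ) (n : ℤ) : ‖qp τ ((n : ℂ) - 1 / 2)‖ =
    Real.exp (2 * Real.pi * τ.im * (1 / 2 - n)) := by
  rw [qp, Complex.norm_exp]
  congr 1
  rw [show 2 * (Real.pi : ℂ) * Complex.I * τ * ((n : ℂ) - 1 / 2) =
    ((2 * Real.pi * (n - 1 / 2) : ℝ) : ℂ) * (Complex.I * τ) by push_cast; ring,
    Complex.re_ofReal_mul, Complex.I_mul_re]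
  ring

lemma c_finite {τ : ℂ} (hτ : 0 < τ.im) {x y : ℝ} (hx : 0 < x) (hy : 0 < y) :
    {n : ℤ | x < ‖qp τ ((n : ℂ) - 1 / 2)‖ ∧ ‖qp τ ((n : ℂ) - 1 / 2)‖ < y}.Finite := by
  have hK : 0 < 2 * Real.pi * τ.im := by positivity
  refine (Set.finite_Icc ⌊1 / 2 - Real.log y / (2 * Real.pi * τ.im)⌋
    ⌈1 / 2 - Real.log x / (2 * Real.pi * τ.im)⌉).subset ?_
  rintro n ⟨h1, h2⟩
  rw [c_norm] at h1 h2
  rw [← Real.log_lt_iff_lt_exp hx] at h1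
  rw [← Real.lt_log_iff_exp_lt hy] at h2
  constructor
  · have : 1 / 2 - Real.log y / (2 * Real.pi * τ.im) < n := by
      rw [sub_lt_comm, lt_div_iff₀ hK]; linarith
    have h := (Int.floor_le _).trans_lt this
    exact_mod_cast h.le
  · have : (n : ℝ) < 1 / 2 - Real.log x / (2 * Real.pi * τ.im) := by
      rw [lt_sub_comm, div_lt_iff₀ hK]; linarith
    have h := this.trans_le (Int.le_ceil _)
    exact_mod_cast h.le

lemma lower {τ : ℂ} (hτ : 0 < τ.im) {w₀ : ℂ} (hw : w₀ ≠ 0) : ∃ ε : ℝ, 0 < ε ∧ ∀ n : ℤ,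
    w₀ * qp τ ((n : ℂ) - 1 / 2) ≠ 1 →
    ε * (1 + ‖qp τ ((n : ℂ) - 1 / 2)‖) ≤ ‖1 - w₀ * qp τ ((n : ℂ) - 1 / 2)‖ := by
  have hw' : 0 < ‖w₀‖ := norm_pos_iff.mpr hw
  set W := ‖w₀‖
  have hS := c_finite hτ (x := 1 / (2 * W)) (y := 2 / W) (by positivity) (by positivity)
  have h1 : ∀ᶠ ε : ℝ in 𝓝[>] 0, ∀ n ∈ {n : ℤ | 1 / (2 * W) < ‖qp τ ((n : ℂ) - 1 / 2)‖ ∧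
      ‖qp τ ((n : ℂ) - 1 / 2)‖ < 2 / W}, w₀ * qp τ ((n : ℂ) - 1 / 2) ≠ 1 →
      ε * (1 + ‖qp τ ((n : ℂ) - 1 / 2)‖) ≤ ‖1 - w₀ * qp τ ((n : ℂ) - 1 / 2)‖ := by
    rw [Filter.eventually_all_finite hS]
    intro n _
    by_cases hn : w₀ * qp τ ((n : ℂ) - 1 / 2) = 1
    · exact Eventually.of_forall fun _ h => absurd hn h
    have hp : 0 < ‖1 - w₀ * qp τ ((n : ℂ) - 1 / 2)‖ :=
      norm_pos_iff.mpr (sub_ne_zero.mpr (Ne.symm hn))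
    have ht : Tendsto (fun ε : ℝ => ε * (1 + ‖qp τ ((n : ℂ) - 1 / 2)‖)) (𝓝[>] 0)
        (𝓝 (0 * (1 + ‖qp τ ((n : ℂ) - 1 / 2)‖))) :=
      (Continuous.tendsto (by fun_prop) _).mono_left nhdsWithin_le_nhds
    rw [zero_mul] at ht
    filter_upwards [ht.eventually_lt_const hp] with ε hε _ using hε.le
  have h2 : ∀ᶠ ε : ℝ in 𝓝[>] 0, ε < W / (2 * W + 2) :=
    (eventually_lt_nhds (by positivity)).filter_mono nhdsWithin_le_nhds
  obtain ⟨ε, h1, h2, h3⟩ := (h1.and (h2.and self_mem_nhdsWithin)).exists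
  have h3 : 0 < ε := h3
  refine ⟨ε, h3, fun n hn => ?_⟩
  rw [lt_div_iff₀ (by positivity)] at h2
  set C := ‖qp τ ((n : ℂ) - 1 / 2)‖ with hC
  have hC0 : 0 ≤ C := norm_nonneg _
  by_cases hs : 1 / (2 * W) < C
  · by_cases hl : C < 2 / W
    · exact h1 n ⟨hs, hl⟩ hn
    · have hl' : 2 ≤ W * C := by
        rw [not_lt, div_le_iff₀ hw'] at hl; linarith
      have := norm_sub_norm_le (w₀ * qp τ ((n : ℂ) - 1 / 2)) 1
      rw [norm_mul, norm_one, norm_sub_rev] at this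
      have h5 : W * C / 2 ≤ W * C - 1 := by linarith
      refine le_trans ?_ (h5.trans this)
      nlinarith [mul_nonneg hC0 h3.le]
  · have hs' : W * C ≤ 1 / 2 := by
      rw [not_lt, le_div_iff₀ (by positivity)] at hs; linarith
    have := norm_sub_norm_le 1 (w₀ * qp τ ((n : ℂ) - 1 / 2))
    rw [norm_mul, norm_one] at this
    have h5 : 1 / 2 ≤ 1 - W * C := by linarith
    refine le_trans ?_ (h5.trans this)
    have : W * (ε * (1 + C)) ≤ W * (1 / 2) := by nlinarith
    exact le_of_mul_le_mul_left this hw'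

lemma a_summable {τ : ℂ} (hτ : 0 < τ.im) :
    Summable fun n : ℤ => ‖(-1 : ℂ) ^ n * qp τ ((n : ℂ) ^ 2 / 2 - 1 / 8)‖ := by
  have h := (((summable_jacobiTheta₂_term_iff 0 τ).mpr hτ).norm).mul_left ‖qp τ (-1 / 8)‖
  refine h.congr fun n => ?_
  rw [norm_mul, norm_zpow, norm_neg, norm_one, one_zpow, one_mul, ← norm_mul]
  congr 1
  rw [qp, qp, jacobiTheta₂_term, ← Complex.exp_add]
  congr 1; ring

lemma S_summable {τ : ℂ} (hτ : 0 < τ.im) {w : ℂ} (hw : w ≠ 0) {b : ℤ → ℂ}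
    (hb : Summable fun n => ‖b n‖) :
    Summable fun n : ℤ => b n / (1 - w * qp τ ((n : ℂ) - 1 / 2)) := by
  obtain ⟨ε, hε, h⟩ := lower hτ hw
  refine (hb.mul_left (1 / ε)).of_norm_bounded fun n => ?_
  by_cases hn : w * qp τ ((n : ℂ) - 1 / 2) = 1
  · rw [hn]; simp; positivity
  · have h1 := h n hn
    have h2 : ε ≤ ‖1 - w * qp τ ((n : ℂ) - 1 / 2)‖ := by
      nlinarith [norm_nonneg (qp τ ((n : ℂ) - 1 / 2))]
    rw [norm_div, div_eq_mul_inv, mul_comm, one_div ε]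
    gcongr

lemma S_analytic {τ : ℂ} (hτ : 0 < τ.im) {w₀ : ℂ} (hw : w₀ ≠ 0) {b : ℤ → ℂ}
    (hb : Summable fun n => ‖b n‖)
    (h0 : ∀ n : ℤ, w₀ * qp τ ((n : ℂ) - 1 / 2) = 1 → b n = 0) :
    AnalyticAt ℂ (fun w => ∑' n : ℤ, b n / (1 - w * qp τ ((n : ℂ) - 1 / 2))) w₀ := by
  obtain ⟨ε, hε, h⟩ := lower hτ hw
  have key : ∀ n : ℤ, b n ≠ 0 → ∀ w ∈ Metric.ball w₀ (ε / 2),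
      ε / 2 ≤ ‖1 - w * qp τ ((n : ℂ) - 1 / 2)‖ := by
    intro n hn w hw
    have h1 := h n fun h => hn (h0 n h)
    rw [Metric.mem_ball, dist_eq_norm] at hw
    have h2 := norm_sub_norm_le (1 - w₀ * qp τ ((n : ℂ) - 1 / 2))
      ((w - w₀) * qp τ ((n : ℂ) - 1 / 2))
    rw [show 1 - w₀ * qp τ ((n : ℂ) - 1 / 2) - (w - w₀) * qp τ ((n : ℂ) - 1 / 2) =
      1 - w * qp τ ((n : ℂ) - 1 / 2) by ring, norm_mul] at h2
    nlinarith [norm_nonneg (qp τ ((n : ℂ) - 1 / 2))]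
  have hd : DifferentiableOn ℂ (fun w => ∑' n : ℤ, b n / (1 - w * qp τ ((n : ℂ) - 1 / 2)))
      (Metric.ball w₀ (ε / 2)) := by
    refine differentiableOn_tsum_of_summable_norm (hb.mul_left (2 / ε)) ?_ Metric.isOpen_ball ?_
    · intro n
      by_cases hn : b n = 0
      · simp [hn]
      · refine DifferentiableOn.div (by fun_prop) (by fun_prop) fun w hw h => ?_
        have := key n hn w hw
        rw [h, norm_zero] at this
        linarith
    · intro n w hw
      by_cases hn : b n = 0
      · simp [hn]
      · have := key n hn w hw
        rw [norm_div, div_eq_mul_inv, mul_comm]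
        have h3 : (2 / ε) = (ε / 2)⁻¹ := by rw [inv_div]
        rw [h3]
        gcongr
  exact hd.analyticAt (Metric.ball_mem_nhds _ (by positivity))

lemma F_analytic {τ : ℂ} (hτ : 0 < τ.im) {ρ₀ : ℂ}
    (h : ∀ n : ℤ, Complex.exp (2 * (Real.pi : ℂ) * Complex.I * ρ₀) * qp τ ((n : ℂ) - 1 / 2) ≠ 1) :
    AnalyticAt ℂ (fun ρ => Fe τ ρ) ρ₀ := by
  have hS := S_analytic hτ (Complex.exp_ne_zero (2 * (Real.pi : ℂ) * Complex.I * ρ₀))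
    (a_summable hτ) fun n hn => absurd hn (h n)
  have he : AnalyticAt ℂ (fun ρ : ℂ => Complex.exp (2 * (Real.pi : ℂ) * Complex.I * ρ)) ρ₀ := by
    fun_prop
  have hc := AnalyticAt.fun_comp (f := fun ρ : ℂ =>
    Complex.exp (2 * (Real.pi : ℂ) * Complex.I * ρ)) hS he
  unfold Fe
  refine AnalyticAt.mul ?_ hc
  have : theta4 τ ≠ 0 := th4_ne hτ
  fun_prop (disch := assumption)

lemma F_res {τ : ℂ} (hτ : 0 < τ.im) {ρ₀ : ℂ} (N : ℤ)
    (h : Complex.exp (2 * (Real.pi : ℂ) * Complex.I * ρ₀) * qp τ ((N : ℂ) - 1 / 2) = 1) :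
    Tendsto (fun ρ => (ρ - ρ₀) * Fe τ ρ) (𝓝[≠] ρ₀)
      (𝓝 (Complex.exp ((Real.pi : ℂ) * Complex.I * ρ₀) / theta4 τ *
        ((-1 : ℂ) ^ N * qp τ ((N : ℂ) ^ 2 / 2 - 1 / 8)) / (2 * (Real.pi : ℂ) * Complex.I))) := by
  set a : ℤ → ℂ := fun n => (-1 : ℂ) ^ n * qp τ ((n : ℂ) ^ 2 / 2 - 1 / 8) with ha
  set b : ℤ → ℂ := fun n => if n = N then 0 else a n with hb
  have hbs : Summable fun n => ‖b n‖ := by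
    refine Summable.of_nonneg_of_le (fun n => norm_nonneg _) (fun n => ?_) (a_summable hτ)
    simp only [hb]
    split_ifs
    · rw [norm_zero]; exact norm_nonneg _
    · exact le_rfl
  have hb0 : ∀ n : ℤ, Complex.exp (2 * (Real.pi : ℂ) * Complex.I * ρ₀) *
      qp τ ((n : ℂ) - 1 / 2) = 1 → b n = 0 := by
    intro n hn
    have h1 : qp τ ((n : ℂ) - 1 / 2) = qp τ ((N : ℂ) - 1 / 2) :=
      mul_left_cancel₀ (Complex.exp_ne_zero _) (hn.trans h.symm)
    have h2 := congrArg norm h1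
    rw [c_norm, c_norm, Real.exp_eq_exp] at h2
    have hK : 2 * Real.pi * τ.im ≠ 0 := by positivity
    have h3 := mul_left_cancel₀ hK h2
    have h4 : (n : ℝ) = N := by linarith
    have h5 : n = N := by exact_mod_cast h4
    simp [hb, h5]
  have hS := (S_analytic hτ (Complex.exp_ne_zero (2 * (Real.pi : ℂ) * Complex.I * ρ₀))
    hbs hb0).continuousAt
  have he : ContinuousAt (fun ρ : ℂ => Complex.exp (2 * (Real.pi : ℂ) * Complex.I * ρ)) ρ₀ := by
    fun_prop
  have hc := (ContinuousAt.comp' (f := fun ρ : ℂ => Complex.exp (2 * (Real.pi : ℂ) * Complex.I * ρ))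
    hS he).tendsto.mono_left (nhdsWithin_le_nhds (s := {ρ₀}ᶜ))
  have hz : Tendsto (fun ρ : ℂ => ρ - ρ₀) (𝓝[≠] ρ₀) (𝓝 0) := by
    have : Tendsto (fun ρ : ℂ => ρ - ρ₀) (𝓝 ρ₀) (𝓝 (ρ₀ - ρ₀)) := Continuous.tendsto (by fun_prop) _
    rw [sub_self] at this
    exact this.mono_left nhdsWithin_le_nhds
  have hm := ((exp_slope ρ₀).inv₀ Complex.two_pi_I_ne_zero).mul_const (-a N)
  have hp : Tendsto (fun ρ : ℂ => -(Complex.exp ((Real.pi : ℂ) * Complex.I * ρ) / theta4 τ))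
      (𝓝[≠] ρ₀) (𝓝 (-(Complex.exp ((Real.pi : ℂ) * Complex.I * ρ₀) / theta4 τ))) :=
    (Continuous.tendsto (by fun_prop) _).mono_left nhdsWithin_le_nhds
  have ht := hp.mul (hm.add (hz.mul hc))
  convert ht using 2
  · rename_i ρ
    have hs := (S_summable hτ (Complex.exp_ne_zero (2 * (Real.pi : ℂ) * Complex.I * ρ))
      (a_summable hτ)).tsum_eq_add_tsum_ite N
    rw [Fe, hs]
    have hsum : (∑' n : ℤ, if n = N then 0 else (-1 : ℂ) ^ n * qp τ ((n : ℂ) ^ 2 / 2 - 1 / 8) /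
        (1 - Complex.exp (2 * (Real.pi : ℂ) * Complex.I * ρ) * qp τ ((n : ℂ) - 1 / 2))) =
        ∑' n : ℤ, b n /
        (1 - Complex.exp (2 * (Real.pi : ℂ) * Complex.I * ρ) * qp τ ((n : ℂ) - 1 / 2)) := by
      refine tsum_congr fun n => ?_
      simp only [hb]
      split_ifs <;> simp [ha]
    rw [hsum]
    have hden : Complex.exp (2 * (Real.pi : ℂ) * Complex.I * ρ) * qp τ ((N : ℂ) - 1 / 2) =
        Complex.exp (2 * (Real.pi : ℂ) * Complex.I * (ρ - ρ₀)) := by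
      rw [mul_sub, Complex.exp_sub, eq_div_iff (Complex.exp_ne_zero _)]
      linear_combination Complex.exp (2 * (Real.pi : ℂ) * Complex.I * ρ) * h
    rw [hden, show (1 - Complex.exp (2 * (Real.pi : ℂ) * Complex.I * (ρ - ρ₀))) =
      -(Complex.exp (2 * (Real.pi : ℂ) * Complex.I * (ρ - ρ₀)) - 1) by ring, div_neg, inv_div]
    simp only [ha]
    ring
  · simp only [ha]
    field_simp
    ring

lemma F_cond {τ ρ : ℂ} {n : ℤ}
    (h : Complex.exp (2 * (Real.pi : ℂ) * Complex.I * ρ) * qp τ ((n : ℂ) - 1 / 2) = 1) :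
    ∃ k : ℤ, ρ = (((2 * k : ℤ) : ℂ) + ((1 - 2 * n : ℤ) : ℂ) * τ) / 2 := by
  rw [qp, ← Complex.exp_add, Complex.exp_eq_one_iff] at h
  obtain ⟨k, hk⟩ := h
  refine ⟨k, ?_⟩
  apply mul_left_cancel₀ Complex.two_pi_I_ne_zero
  push_cast
  linear_combination hk

lemma lat_unique {τ : ℂ} (hτ : 0 < τ.im) {m n m' n' : ℤ}
    (h : ((m : ℂ) + (n : ℂ) * τ) / 2 = ((m' : ℂ) + (n' : ℂ) * τ) / 2) : m = m' ∧ n = n' := by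
  have h1 : (m : ℂ) + (n : ℂ) * τ = (m' : ℂ) + (n' : ℂ) * τ := by linear_combination 2 * h
  have h2 := congrArg Complex.im h1
  simp at h2
  have hn : n = n' := by
    rcases h2 with h2 | h2
    · exact h2
    · exact absurd h2 hτ.ne'
  subst hn
  refine ⟨?_, rfl⟩
  have h3 : (m : ℂ) = m' := by linear_combination h1
  exact_mod_cast h3

lemma r_analytic {τ : ℂ} (hτ : 0 < τ.im) {ρ : ℂ}
    (h : ¬ ∃ m n : ℤ, ¬(Even m ∧ Even n) ∧ ρ = ((m : ℂ) + (n : ℂ) * τ) / 2) :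
    AnalyticAt ℂ (fun z => rJ τ z) ρ := by
  have a2 := (th2_diff hτ).analyticAt ρ
  have a3 := (th3_diff hτ).analyticAt ρ
  have a4 := (th4_diff hτ).analyticAt ρ
  have n3 : theta3e τ ρ ≠ 0 := by
    intro h0
    rw [th3_eq] at h0
    obtain ⟨m, n, hm, hn, e⟩ := J_zero hτ h0
    exact h ⟨m, n, fun h' => (Int.not_even_iff_odd.mpr hm) h'.1, e⟩
  have n4 : theta4e τ ρ ≠ 0 := by
    intro h0
    rw [th4_eq] at h0
    obtain ⟨m, n, hm, hn, e⟩ := J_zero hτ h0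
    refine h ⟨m - 1, n, fun h' => (Int.not_even_iff_odd.mpr hn) h'.2, ?_⟩
    push_cast
    linear_combination e
  have n2 : theta2e τ ρ ≠ 0 := by
    intro h0
    rw [th2_eq, mul_eq_zero, or_iff_right (mul_ne_zero (qp_ne _ _) (Complex.exp_ne_zero _))] at h0
    obtain ⟨m, n, hm, hn, e⟩ := J_zero hτ h0
    refine h ⟨m, n - 1, fun h' => (Int.not_even_iff_odd.mpr hm) h'.1, ?_⟩
    push_cast
    linear_combination e
  unfold rJ
  exact AnalyticAt.div (by fun_prop) (by fun_prop) (mul_ne_zero (mul_ne_zero n2 n3) n4)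

lemma F_analytic_of {τ : ℂ} (hτ : 0 < τ.im) {m n : ℤ} (h : Odd m) :
    AnalyticAt ℂ (fun z => Fe τ z) (((m : ℂ) + (n : ℂ) * τ) / 2) := by
  refine F_analytic hτ fun k hk => ?_
  obtain ⟨l, hl⟩ := F_cond hk
  have := (lat_unique hτ hl).1
  rw [this] at h
  exact (Int.not_even_iff_odd.mpr h) ⟨l, by ring⟩

lemma H_res_odd {τ : ℂ} (hτ : 0 < τ.im) {m n : ℤ} (h : Odd m) {ρ₁ c : ℂ}
    (hρ : ρ₁ = ((m : ℂ) + (n : ℂ) * τ) / 2)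
    (hr : Tendsto (fun ρ => (ρ - ρ₁) * rJ τ ρ) (𝓝[≠] ρ₁) (𝓝 c)) :
    Tendsto (fun ρ => (ρ - ρ₁) * HJ τ ρ) (𝓝[≠] ρ₁) (𝓝 (-c)) := by
  have hF := (F_analytic_of hτ (n := n) h).continuousAt
  rw [← hρ] at hF
  have hF' := hF.tendsto.mono_left (nhdsWithin_le_nhds (s := {ρ₁}ᶜ))
  have hz : Tendsto (fun ρ : ℂ => ρ - ρ₁) (𝓝[≠] ρ₁) (𝓝 0) := by
    have : Tendsto (fun ρ : ℂ => ρ - ρ₁) (𝓝 ρ₁) (𝓝 (ρ₁ - ρ₁)) := Continuous.tendsto (by fun_prop) _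
    rw [sub_self] at this
    exact this.mono_left nhdsWithin_le_nhds
  have t := ((hz.mul hF').const_mul 24).sub hr
  convert t using 2
  · rw [HJ]; ring
  · ring

lemma H_res_even {τ : ℂ} (hτ : 0 < τ.im) (a b : ℤ) :
    Tendsto (fun ρ => (ρ - (τ / 2 + (a + b * τ))) * HJ τ ρ) (𝓝[≠] (τ / 2 + (a + b * τ)))
      (𝓝 (mu τ a b (τ / 2) * (-4 * Complex.I * qp τ (1 / 8) / ((Real.pi : ℂ) * theta4 τ)))) := by
  have hr := r_res_shift a b (r_res_tau hτ)
  have hF := F_res hτ (ρ₀ := τ / 2 + (a + b * τ)) (-b) (by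
    rw [qp, ← Complex.exp_add, Complex.exp_eq_one_iff]
    exact ⟨a, by push_cast; ring⟩)
  have t := (hF.const_mul 24).sub hr
  convert t using 2
  · rw [HJ]; ring
  · have e : Complex.exp ((Real.pi : ℂ) * Complex.I * (τ / 2 + (a + b * τ))) *
        ((-1 : ℂ) ^ (-b) * qp τ ((((-b : ℤ) : ℂ)) ^ 2 / 2 - 1 / 8)) =
        mu τ a b (τ / 2) * qp τ (1 / 8) := by
      have hb : (-1 : ℂ) ^ (-b) = (-1 : ℂ) ^ b := by
        rw [zpow_neg, ← inv_zpow]; norm_num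
      rw [hb, neg_one_zpow_eq, qp, qp, mu, ← Complex.exp_add, ← Complex.exp_add, ← Complex.exp_add]
      congr 1
      push_cast
      ring
    have h4 := th4_ne hτ
    have hpi : (Real.pi : ℂ) ≠ 0 := by exact_mod_cast Real.pi_ne_zero
    rw [div_mul_eq_mul_div, e]
    have hI := Complex.I_ne_zero
    field_simp
    rw [Complex.I_sq]
    ring

lemma mu_ne (τ : ℂ) (a b : ℤ) (ρ : ℂ) : mu τ a b ρ ≠ 0 := Complex.exp_ne_zero _

/-- Pole structure of `H(τ,·)`: it is analytic away from the half-lattice points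
`ρ = (m+nτ)/2` with `m, n` not both even, it has a simple pole at each such point,
and `Res_{ρ=1/2} H = 4/(πθ₂(τ))`, `Res_{ρ=τ/2} H = −4iq^{1/8}/(πθ₄(τ))`,
`Res_{ρ=(1+τ)/2} H = 4q^{1/8}/(πθ₃(τ))`. -/
theorem H_pole_structure (τ : ℂ) (hτ : 0 < τ.im) :
    (∀ ρ : ℂ,
      (¬ ∃ m n : ℤ, ¬(Even m ∧ Even n) ∧ ρ = ((m : ℂ) + (n : ℂ) * τ) / 2) →
      AnalyticAt ℂ (fun z => HJ τ z) ρ) ∧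
    (∀ m n : ℤ, ¬(Even m ∧ Even n) →
      ∃ c : ℂ, c ≠ 0 ∧
        Tendsto (fun ρ => (ρ - ((m : ℂ) + (n : ℂ) * τ) / 2) * HJ τ ρ)
          (𝓝[≠] (((m : ℂ) + (n : ℂ) * τ) / 2)) (𝓝 c)) ∧
    Tendsto (fun ρ => (ρ - 1 / 2) * HJ τ ρ) (𝓝[≠] ((1 : ℂ) / 2))
      (𝓝 (4 / ((Real.pi : ℂ) * theta2 τ))) ∧
    Tendsto (fun ρ => (ρ - τ / 2) * HJ τ ρ) (𝓝[≠] (τ / 2))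
      (𝓝 (-4 * Complex.I * qp τ (1 / 8) / ((Real.pi : ℂ) * theta4 τ))) ∧
    Tendsto (fun ρ => (ρ - (1 + τ) / 2) * HJ τ ρ) (𝓝[≠] ((1 + τ) / 2))
      (𝓝 (4 * qp τ (1 / 8) / ((Real.pi : ℂ) * theta3 τ))) := by
  have h2 := th2_ne hτ
  have h3 := th3_ne hτ
  have h4 := th4_ne hτ
  have hpi : (Real.pi : ℂ) ≠ 0 := by exact_mod_cast Real.pi_ne_zero
  have hq := qp_ne τ (1 / 8)
  refine ⟨fun ρ h => ?_, fun m n h => ?_, ?_, ?_, ?_⟩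
  · have hF : AnalyticAt ℂ (fun z => Fe τ z) ρ := by
      refine F_analytic hτ fun k hk => ?_
      obtain ⟨l, hl⟩ := F_cond hk
      refine h ⟨_, _, fun h' => ?_, hl⟩
      obtain ⟨x, hx⟩ := h'.2
      omega
    have hr := r_analytic hτ h
    unfold HJ
    fun_prop
  · rcases Int.even_or_odd m with hm | hm
    · have hn : Odd n := Int.not_even_iff_odd.mp fun h' => h ⟨hm, h'⟩
      obtain ⟨a, ha⟩ := hm
      obtain ⟨b, hb⟩ := hn
      have e : ((m : ℂ) + (n : ℂ) * τ) / 2 = τ / 2 + (a + b * τ) := by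
        rw [ha, hb]; push_cast; ring
      rw [e]
      exact ⟨_, mul_ne_zero (mu_ne _ _ _ _) (div_ne_zero (mul_ne_zero (mul_ne_zero (by norm_num)
        Complex.I_ne_zero) hq) (mul_ne_zero hpi h4)), H_res_even hτ a b⟩
    · rcases Int.even_or_odd n with hn | hn
      · obtain ⟨a, ha⟩ := id hm
        obtain ⟨b, hb⟩ := hn
        have e : ((m : ℂ) + (n : ℂ) * τ) / 2 = 1 / 2 + (a + b * τ) := by
          rw [ha, hb]; push_cast; ring
        have t := H_res_odd hτ hm e.symm (r_res_shift a b (r_res_half hτ))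
        rw [← e] at t
        exact ⟨_, neg_ne_zero.mpr (mul_ne_zero (mu_ne _ _ _ _) (div_ne_zero (by norm_num)
          (mul_ne_zero hpi h2))), t⟩
      · obtain ⟨a, ha⟩ := id hm
        obtain ⟨b, hb⟩ := hn
        have e : ((m : ℂ) + (n : ℂ) * τ) / 2 = (1 + τ) / 2 + (a + b * τ) := by
          rw [ha, hb]; push_cast; ring
        have t := H_res_odd hτ hm e.symm (r_res_shift a b (r_res_mid hτ))
        rw [← e] at t
        exact ⟨_, neg_ne_zero.mpr (mul_ne_zero (mu_ne _ _ _ _) (div_ne_zero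
          (mul_ne_zero (by norm_num) hq) (mul_ne_zero hpi h3))), t⟩
  · have t := H_res_odd hτ (m := 1) (n := 0) (by decide) (by push_cast; ring) (r_res_half hτ)
    rwa [← neg_div, neg_neg] at t
  · have t := H_res_even hτ 0 0
    simpa [mu] using t
  · have t := H_res_odd hτ (m := 1) (n := 1) (by decide) (by push_cast; ring) (r_res_mid hτ)
    rwa [← neg_div, neg_mul, neg_neg] at t
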